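/- Let G = <x, y | x^q = y^n = 1, x^g y = y x> with q prime and ord_q(g) = n, and H = <x>. If T is a sequence over G with |T| >= q and Pi(T) meets H, then T contains a nonempty product-one subsequence. -/

import Mathlib

open List Subgroup

/-- The set of all products of the terms of `S` in all orders. -/
def PiSet {G : Type*} [Group G] (S : List G) : Set G :=
  {g | ∃ l : List G, l.Perm S ∧ l.prod = g}

/-- `S` is a product-one sequence if `1 ∈ Π(S)`. -/
def IsProdOne {G : Type*} [Group G] (S : List G) : Prop :=
  (1 : G) ∈ PiSet S

/-- The Davenport constant `d(G)`: the smallest `m` such that every sequence of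
length `m` over `G` contains a nonempty product-one subsequence. -/
noncomputable def dC (G : Type*) [Group G] : ℕ :=
  sInf {m | 0 < m ∧ ∀ S : List G, S.length = m →
    ∃ T : List G, T ≠ [] ∧ T.Sublist S ∧ IsProdOne T}

/-- `e(G)`: the smallest `m` such that every nonempty product-one sequence over `G`
contains a nonempty product-one subsequence of length at most `m`. -/
noncomputable def eC (G : Type*) [Group G] : ℕ :=
  sInf {m | 0 < m ∧ ∀ S : List G, S ≠ [] → IsProdOne S →
    ∃ T : List G, T ≠ [] ∧ T.Sublist S ∧ T.length ≤ m ∧ IsProdOne T}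

/-- `f(G)`: the smallest `m` such that every sequence of length `d(G)` over `G`
contains a nonempty product-one subsequence of length at most `m`. -/
noncomputable def fC (G : Type*) [Group G] : ℕ :=
  sInf {m | 0 < m ∧ ∀ S : List G, S.length = dC G →
    ∃ T : List G, T ≠ [] ∧ T.Sublist S ∧ T.length ≤ m ∧ IsProdOne T}

/-- The `k`-th Davenport constant `d_k(G)`: the smallest `m` such that every sequence of
length `m` over `G` contains `k` pairwise disjoint nonempty product-one subsequences. -/
noncomputable def dkC (G : Type*) [Group G] (k : ℕ) : ℕ :=
  sInf {m | 0 < m ∧ ∀ S : List G, S.length = m →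
    ∃ Ts : List (List G), Ts.length = k ∧ (∀ T ∈ Ts, T ≠ [] ∧ IsProdOne T) ∧
      (Ts.flatten : Multiset G) ≤ (S : Multiset G)}

open scoped Finset Pointwise

/-- If `S` is a shortest nonempty sequence among its subsequences with product in the kernel,
then its cyclic rotations have pairwise distinct products. -/
theorem exists_kernel_rotations {G A : Type*} [Group G] [CommGroup A] (f : G →* A)
    (hc : ∀ h : G, f h = 1 → h ≠ 1 → ∀ u, Commute u h → f u = 1)
    (S : List G) (hS : f S.prod = 1) (hS1 : S.prod ≠ 1)
    (hmin : ∀ U : List G, U.Sublist S → U ≠ [] → f U.prod = 1 → S.length ≤ U.length) :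
    ∃ B : Finset f.ker, #B = S.length ∧ ∀ b ∈ B, ∃ U : List G, U.Perm S ∧ U.prod = b := by
  classical
  have hrot (i : ℕ) : (S.drop i ++ S.take i).prod =
      (S.take i).prod⁻¹ * S.prod * (S.take i).prod := by
    have h : S.prod = (S.take i).prod * (S.drop i).prod := by
      rw [← List.prod_append, List.take_append_drop]
    rw [h, List.prod_append, inv_mul_cancel_left]
  let r : ℕ → f.ker := fun i ↦ ⟨(S.drop i ++ S.take i).prod, by
    rw [MonoidHom.mem_ker, hrot]
    simp [hS]⟩
  have hlt : ∀ i j, i < j → j < S.length → r i ≠ r j := by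
    intro i j hij hj he
    set p := (S.take i).prod with hp
    set d := ((S.take j).drop i).prod with hd
    have hpd : (S.take j).prod = p * d := by
      rw [hp, hd, ← List.prod_append]
      conv_lhs => rw [← List.take_append_drop i (S.take j)]
      rw [List.take_take, min_eq_left hij.le]
    have he' : p⁻¹ * S.prod * p = (p * d)⁻¹ * S.prod * (p * d) := by
      have := congrArg Subtype.val he
      simpa only [r, hrot, hpd] using this
    have hcomm : Commute d (p⁻¹ * S.prod * p) := by
      change d * (p⁻¹ * S.prod * p) = p⁻¹ * S.prod * p * d
      rw [he']
      conv_rhs => rw [← he']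
      group
    have hd1 : f d = 1 := by
      refine hc (p⁻¹ * S.prod * p) (by simp [hS]) (fun h ↦ hS1 ?_) d hcomm
      have := conj_eq_one_iff (a := p⁻¹) (b := S.prod)
      rw [inv_inv] at this
      exact this.1 h
    have := hmin _ ((List.drop_sublist i _).trans (List.take_sublist j S)) (by
      intro h
      have := congrArg List.length h
      simp at this
      omega) hd1
    simp at this
    omega
  refine ⟨(Finset.range S.length).image r, ?_, ?_⟩
  · rw [Finset.card_image_of_injOn, Finset.card_range]
    intro i hi j hj h
    simp only [Finset.coe_range, Set.mem_Iio] at hi hj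
    rcases lt_trichotomy i j with hij | hij | hij
    · exact (hlt i j hij hj h).elim
    · exact hij
    · exact (hlt j i hij hi h.symm).elim
  · intro b hb
    obtain ⟨i, -, rfl⟩ := Finset.mem_image.1 hb
    exact ⟨S.drop i ++ S.take i, by simpa using List.perm_append_comm (l₁ := S.drop i) (l₂ := S.take i), rfl⟩

/-- In a finite group, two sets whose sizes add up to more than the group order have `1` in their
product set. -/
theorem one_mem_mul_of_card_lt {K : Type*} [Group K] [Finite K] [DecidableEq K] {A B : Finset K}
    (h : Nat.card K < #A + #B) : (1 : K) ∈ A * B := by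
  have := Fintype.ofFinite K
  obtain ⟨a, ha⟩ := Finset.inter_nonempty_of_card_lt_card_add_card
    (Finset.subset_univ A) (Finset.subset_univ B⁻¹)
    (by rwa [Finset.card_inv, Finset.card_univ, ← Nat.card_eq_fintype_card])
  rw [Finset.mem_inter, Finset.mem_inv'] at ha
  exact Finset.mem_mul.2 ⟨a, ha.1, a⁻¹, ha.2, mul_inv_cancel a⟩

/-- The **Cauchy-Davenport theorem** in a group of prime order. -/
theorem min_card_le_card_mul_of_prime {K : Type*} [Group K] [DecidableEq K]
    (hK : (Nat.card K).Prime) {A B : Finset K} (hA : A.Nonempty) (hB : B.Nonempty) :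
    min (Nat.card K) (#A + #B - 1) ≤ #(A * B) := by
  have : Fact (Nat.card K).Prime := ⟨hK⟩
  have h : (Nat.card K : ℕ∞) ≤ Monoid.minOrder K :=
    Monoid.le_minOrder.2 fun a ha _ ↦ by rw [orderOf_eq_card_of_zpowers_eq_top
      (Subgroup.eq_top_iff' _ |>.2 fun b ↦ mem_zpowers_of_prime_card rfl ha)]
  have := (min_le_min_right _ h).trans (cauchy_davenport_minOrder_mul hA hB)
  rw [min_le_iff] at this ⊢
  exact_mod_cast this

/-- A sequence with product in the kernel and no nonempty product-one subsequence has more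
kernel elements among its subsequence products than it has terms. -/
theorem length_lt_card_kernel_products {G A : Type*} [Group G] [CommGroup A] (f : G →* A)
    (hf : (Nat.card f.ker).Prime)
    (hc : ∀ h : G, f h = 1 → h ≠ 1 → ∀ u, Commute u h → f u = 1)
    (T : List G) (hT : f T.prod = 1) (hfree : ∀ U : List G, U <+~ T → U.prod = 1 → U = []) :
    ∃ B : Finset f.ker, T.length < #B ∧ ∀ b ∈ B, ∃ U : List G, U <+~ T ∧ U.prod = b := by
  classical
  have : Finite f.ker := (Nat.card_pos_iff.1 hf.pos).2
  induction hn : T.length using Nat.strong_induction_on generalizing T with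
  | _ n ih =>
  subst hn
  rcases eq_or_ne T [] with rfl | hne
  · exact ⟨{1}, by simp, fun b hb ↦ ⟨[], by simp, by simp [Finset.mem_singleton.1 hb]⟩⟩
  have hex : ∃ m, ∃ S : List G, S.Sublist T ∧ S ≠ [] ∧ f S.prod = 1 ∧ S.length = m :=
    ⟨_, T, List.Sublist.refl T, hne, hT, rfl⟩
  obtain ⟨S, hST, hS0, hS, hSm⟩ := Nat.find_spec hex
  obtain ⟨R, hR⟩ := hST.exists_perm_append
  have hRT : R <+~ T := (List.sublist_append_right S R).subperm.trans hR.symm.subperm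
  have hRf : f R.prod = 1 := by
    have := (hR.map f).prod_eq
    rw [List.map_append, List.prod_append, ← map_list_prod, ← map_list_prod, ← map_list_prod,
      hT, hS, one_mul] at this
    exact this.symm
  have hlen : T.length = S.length + R.length := by rw [hR.length_eq, List.length_append]
  have hSpos : 0 < S.length := List.length_pos_iff.2 hS0
  obtain ⟨B, hB, hBU⟩ := ih R.length (by omega) R hRf
    (fun U hU ↦ hfree U (hU.trans hRT)) rfl
  obtain ⟨C, hC, hCU⟩ := exists_kernel_rotations f hc S hS
    (fun h ↦ hS0 (hfree S hST.subperm h))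
    (fun U hU hU0 hU1 ↦ hSm.le.trans (Nat.find_min' hex ⟨U, hU.trans hST, hU0, hU1, rfl⟩))
  have hmul {U V : List G} (hU : U <+~ R) (hV : V <+~ S) : U ++ V <+~ T :=
    (hU.append hV).trans (List.perm_append_comm.trans hR.symm).subperm
  have hCB : #B + #C ≤ Nat.card f.ker := by
    by_contra! h
    obtain ⟨b, hb, c, hc', hbc⟩ := Finset.mem_mul.1 (one_mem_mul_of_card_lt h)
    obtain ⟨U, hU, hUb⟩ := hBU b hb
    obtain ⟨V, hV, hVc⟩ := hCU c hc'
    have := hfree _ (hmul hU hV.subperm)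
      (by rw [List.prod_append, hUb, hVc, ← Subgroup.coe_mul, hbc, Subgroup.coe_one])
    rw [(List.append_eq_nil_iff.1 this).2] at hV
    exact hS0 hV.symm.eq_nil
  have h1C : (1 : f.ker) ∉ C := fun h ↦ by
    obtain ⟨V, hV, hV1⟩ := hCU 1 h
    rw [hfree V (hV.subperm.trans hST.subperm) hV1] at hV
    exact hS0 hV.symm.eq_nil
  refine ⟨B * insert 1 C, ?_, ?_⟩
  · have := min_card_le_card_mul_of_prime hf (A := B) (B := insert 1 C)
      (Finset.card_pos.1 (by omega)) (Finset.insert_nonempty 1 C)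
    rw [Finset.card_insert_of_notMem h1C] at this
    omega
  · intro x hx
    obtain ⟨b, hb, c, hc', rfl⟩ := Finset.mem_mul.1 hx
    obtain ⟨U, hU, hUb⟩ := hBU b hb
    rcases Finset.mem_insert.1 hc' with rfl | hc'
    · exact ⟨U, hU.trans hRT, by simpa using hUb⟩
    · obtain ⟨V, hV, hVc⟩ := hCU c hc'
      exact ⟨U ++ V, hmul hU hV.subperm, by simp [hUb, hVc]⟩

/-- A sequence at least as long as the order of the kernel and with product in the kernel contains
a nonempty product-one subsequence. -/
theorem exists_isProdOne_of_card_ker_le_length {G A : Type*} [Group G] [CommGroup A] (f : G →* A)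
    (hf : (Nat.card f.ker).Prime)
    (hc : ∀ h : G, f h = 1 → h ≠ 1 → ∀ u, Commute u h → f u = 1)
    (T : List G) (hT : f T.prod = 1) (hlen : Nat.card f.ker ≤ T.length) :
    ∃ T' : List G, T' ≠ [] ∧ T'.Sublist T ∧ IsProdOne T' := by
  have : Finite f.ker := (Nat.card_pos_iff.1 hf.pos).2
  have := Fintype.ofFinite f.ker
  by_contra! hno
  obtain ⟨B, hB, -⟩ := length_lt_card_kernel_products f hf hc T hT (by
    rintro U ⟨V, hVU, hVT⟩ hU
    by_contra hne
    exact hno V (fun h ↦ hne (by subst h; exact hVU.symm.eq_nil)) hVT ⟨U, hVU.symm, hU⟩)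
  have := B.card_le_univ
  rw [← Nat.card_eq_fintype_card] at this
  omega

theorem conj_pow_eq_pow_pow {G : Type*} [Group G] {x y : G} {g : ℕ} (hrel : x ^ g * y = y * x)
    (b : ℕ) : y ^ b * x * (y ^ b)⁻¹ = x ^ g ^ b := by
  have hy : y * x * y⁻¹ = x ^ g := by rw [← hrel, mul_inv_cancel_right]
  induction b with
  | zero => simp
  | succ b ih =>
    calc y ^ (b + 1) * x * (y ^ (b + 1))⁻¹ = y * (y ^ b * x * (y ^ b)⁻¹) * y⁻¹ := by
          rw [pow_succ']; group
      _ = x ^ g ^ (b + 1) := by rw [ih, ← conj_pow, hy, ← pow_mul, pow_succ']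

theorem zpowers_normal_of_conj_eq_pow {G : Type*} [Group G] [Finite G] {x y : G} {g : ℕ}
    (hrel : x ^ g * y = y * x) (hgen : Subgroup.closure ({x, y} : Set G) = ⊤) :
    (Subgroup.zpowers x).Normal := by
  rw [← Subgroup.normalizer_eq_top_iff, eq_top_iff, ← hgen, Subgroup.closure_le]
  rintro z (rfl | rfl)
  · exact Subgroup.le_normalizer (Subgroup.mem_zpowers z)
  · refine Subgroup.mem_normalizer_fintype ?_
    rintro _ ⟨k, rfl⟩
    change z * x ^ k * z⁻¹ ∈ Subgroup.zpowers x
    rw [← conj_zpow, ← hrel, mul_inv_cancel_right]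
    exact Subgroup.zpow_mem _ (Subgroup.npow_mem_zpowers x g) k

/-- In the metacyclic group, the centralizer of `x` is `⟨x⟩`. -/
theorem mem_zpowers_of_commute {q n g : ℕ} (hg : orderOf (g : ZMod q) = n)
    {G : Type*} [Group G] [Finite G] {x y : G} (hordx : orderOf x = q) (hordy : orderOf y = n)
    (hrel : x ^ g * y = y * x) (hgen : Subgroup.closure ({x, y} : Set G) = ⊤)
    {u : G} (hu : Commute u x) : u ∈ Subgroup.zpowers x := by
  have := zpowers_normal_of_conj_eq_pow hrel hgen
  have hu' : u ∈ Subgroup.zpowers x ⊔ Subgroup.zpowers y := by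
    rw [Subgroup.zpowers_eq_closure, Subgroup.zpowers_eq_closure, ← Subgroup.closure_union,
      Set.singleton_union, hgen]
    trivial
  obtain ⟨a, ha, v, hv, rfl⟩ := Subgroup.mem_sup_of_normal_left.1 hu'
  have hax : Commute a x := by
    obtain ⟨k, rfl⟩ := ha
    exact (Commute.refl x).zpow_left k
  have hvx : Commute v x := by simpa using hax.inv_left.mul_left hu
  obtain ⟨b, rfl⟩ := mem_powers_iff_mem_zpowers.2 hv
  have hb : x ^ g ^ b = x ^ 1 := by
    rw [← conj_pow_eq_pow_pow hrel, pow_one]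
    exact mul_inv_eq_of_eq_mul hvx
  rw [pow_eq_pow_iff_modEq, hordx, ← ZMod.natCast_eq_natCast_iff, Nat.cast_pow, Nat.cast_one,
    ← orderOf_dvd_iff_pow_eq_one, hg, ← hordy, orderOf_dvd_iff_pow_eq_one] at hb
  simpa [hb] using ha

/-- In `G = Z_n ⋉ Z_q` with `H = ⟨x⟩`: any sequence `T` with `|T| ≥ q` and `Π(T) ∩ H ≠ ∅`
contains a nonempty product-one subsequence. -/
theorem long_seq_meeting_H_has_product_one (q n g : ℕ) (hq : q.Prime)
    (hg : orderOf (g : ZMod q) = n)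
    (G : Type*) [Group G] [Finite G] (x y : G)
    (hordx : orderOf x = q) (hordy : orderOf y = n)
    (hrel : x ^ g * y = y * x)
    (hgen : Subgroup.closure ({x, y} : Set G) = ⊤)
    (T : List G) (hlen : q ≤ T.length)
    (hmeet : (PiSet T ∩ (Subgroup.zpowers x : Set G)).Nonempty) :
    ∃ T' : List G, T' ≠ [] ∧ T'.Sublist T ∧ IsProdOne T' := by
  have hcardH : Nat.card (Subgroup.zpowers x) = q := by rw [Nat.card_zpowers, hordx]
  have hN := zpowers_normal_of_conj_eq_pow hrel hgen
  let e := IsCyclic.mulAutMulEquiv (Subgroup.zpowers x)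
  let f := e.toMonoidHom.comp (MulAut.conjNormal (H := Subgroup.zpowers x))
  have hfiff (u : G) : f u = 1 ↔ u ∈ Subgroup.zpowers x := by
    have h1 : f u = 1 ↔ MulAut.conjNormal (H := Subgroup.zpowers x) u = 1 :=
      e.map_eq_one_iff
    rw [h1]
    constructor
    · intro h
      refine mem_zpowers_of_commute hg hordx hordy hrel hgen ?_
      have := congrArg Subtype.val (DFunLike.congr_fun h ⟨x, Subgroup.mem_zpowers x⟩)
      rw [MulAut.conjNormal_apply] at this
      exact mul_inv_eq_iff_eq_mul.1 this
    · rintro ⟨k, rfl⟩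
      ext ⟨_, m, rfl⟩
      rw [MulAut.conjNormal_apply]
      exact mul_inv_eq_iff_eq_mul.2 ((Commute.refl x).zpow_zpow k m)
  have hker : f.ker = Subgroup.zpowers x := by
    ext u
    exact hfiff u
  have hprime : (Nat.card f.ker).Prime := by rwa [hker, hcardH]
  obtain ⟨_, ⟨l, hl, rfl⟩, hlH⟩ := hmeet
  refine exists_isProdOne_of_card_ker_le_length f hprime ?_ T ?_ (by rwa [hker, hcardH])
  · intro h hh h1 u hu
    rw [hfiff] at hh ⊢
    refine mem_zpowers_of_commute hg hordx hordy hrel hgen ?_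
    have : Fact q.Prime := ⟨hq⟩
    obtain ⟨k, hk⟩ := mem_zpowers_of_prime_card hcardH (g := ⟨h, hh⟩)
      (g' := ⟨x, Subgroup.mem_zpowers x⟩) (by simpa [Subtype.ext_iff] using h1)
    have hk' : h ^ k = x := congrArg Subtype.val hk
    exact hk' ▸ hu.zpow_right k
  · rw [map_list_prod, ← (hl.map f).prod_eq, ← map_list_prod]
    exact (hfiff _).2 hlH
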